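/- For every n ≥ 2, the system K4CcCn is sound and complete with respect to the class of all K45_n models (models whose relations are transitive and Euclidean, but not necessarily serial): a formula of L_C is derivable in K4CcCn if and only if it is satisfied at every state of every K45 model for n agents. -/

import Mathlib

/-- Formulas of the language `L_C`: atoms, negation, conjunction, common belief `C`. -/
inductive Formula : Type where
  | atom : ℕ → Formula
  | neg  : Formula → Formula
  | and  : Formula → Formula → Formula
  | box  : Formula → Formula

namespace Formula

/-- Implication `φ → ψ` as a derived connective. -/
def imp (φ ψ : Formula) : Formula := neg (and φ (neg ψ))

/-- Disjunction `φ ∨ ψ` as a derived connective. -/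
def or (φ ψ : Formula) : Formula := neg (and (neg φ) (neg ψ))

/-- The diamond `Ĉφ = ¬C¬φ`. -/
def dia (φ : Formula) : Formula := neg (box (neg φ))

/-- A fixed contradiction (used as the empty disjunction). -/
def bot : Formula := and (atom 0) (neg (atom 0))

/-- A fixed tautology (used as the empty conjunction). -/
def top : Formula := neg bot

end Formula

/-- Finite disjunction of a list of formulas. -/
def bigOr (l : List Formula) : Formula := l.foldr Formula.or Formula.bot

/-- Finite conjunction of a list of formulas. -/
def bigAnd (l : List Formula) : Formula := l.foldr Formula.and Formula.top

/-- The list of pairs `(i, j)` with `i < j` in `Fin m`. -/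
def pairs (m : ℕ) : List (Fin m × Fin m) :=
  ((List.finRange m).product (List.finRange m)).filter (fun p => decide (p.1 < p.2))

/-- A Kripke model for `n` agents. -/
structure Model (n : ℕ) where
  W : Type
  nonempty : Nonempty W
  R : Fin n → W → W → Prop
  V : ℕ → W → Prop

/-- `R*`: the transitive closure of the union of the agents' relations. -/
def Model.star {n : ℕ} (M : Model n) : M.W → M.W → Prop :=
  Relation.TransGen (fun x y => ∃ i, M.R i x y)

/-- Satisfaction: `C` quantifies over `R*`-successors. -/
def Sat {n : ℕ} (M : Model n) : M.W → Formula → Prop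
  | s, .atom p => M.V p s
  | s, .neg φ => ¬ Sat M s φ
  | s, .and φ ψ => Sat M s φ ∧ Sat M s ψ
  | s, .box φ => ∀ t, M.star s t → Sat M t φ

/-- A relation is serial if every point has a successor. -/
def Serial {W : Type} (R : W → W → Prop) : Prop := ∀ x, ∃ y, R x y

/-- A relation is Euclidean if `R x y` and `R x z` imply `R y z`. -/
def Euclidean {W : Type} (R : W → W → Prop) : Prop := ∀ x y z, R x y → R x z → R y z

/-- A KD45 model: all agents' relations are serial, transitive and Euclidean. -/
def KD45 {n : ℕ} (M : Model n) : Prop :=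
  ∀ i, Serial (M.R i) ∧ Transitive (M.R i) ∧ Euclidean (M.R i)

/-- `φ` is an instance of a propositional tautology: it is true under every
assignment of truth values to formulas that respects negation and conjunction. -/
def Tautology (φ : Formula) : Prop :=
  ∀ v : Formula → Prop,
    (∀ ψ, v ψ.neg ↔ ¬ v ψ) →
    (∀ ψ χ, v (ψ.and χ) ↔ (v ψ ∧ v χ)) →
    v φ

/-- The axiom `Cn`: `(C ⋀_{i<j}(Cφᵢ ∨ Cφⱼ)) → ⋁_i Cφᵢ`, for `n+1` formulas. -/
def CnAx (n : ℕ) (φ : Fin (n + 1) → Formula) : Formula :=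
  ((bigAnd ((pairs (n + 1)).map (fun p => Formula.or ((φ p.1).box) ((φ p.2).box)))).box).imp
    (bigOr ((List.finRange (n + 1)).map (fun i => (φ i).box)))

/-- The axiom `Ĉn`: `(⋀_i Ĉφᵢ) → Ĉ(⋁_{i<j}(Ĉφᵢ ∧ Ĉφⱼ))`, for `n+1` formulas. -/
def CHatNAx (n : ℕ) (φ : Fin (n + 1) → Formula) : Formula :=
  (bigAnd ((List.finRange (n + 1)).map (fun i => (φ i).dia))).imp
    ((bigOr ((pairs (n + 1)).map (fun p => ((φ p.1).dia).and ((φ p.2).dia)))).dia)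

/-- A K45 model: all agents' relations are transitive and Euclidean
(but not necessarily serial). -/
def K45 {n : ℕ} (M : Model n) : Prop :=
  ∀ i, Transitive (M.R i) ∧ Euclidean (M.R i)

/-- The Hilbert system `K4CcCn`: Prop, K, 4, Cc, Cn, with modus ponens and necessitation. -/
inductive K4CcCn (n : ℕ) : Formula → Prop
  | taut {φ : Formula} : Tautology φ → K4CcCn n φ
  | K (φ ψ : Formula) : K4CcCn n (((φ.imp ψ).box).imp ((φ.box).imp (ψ.box)))
  | four (φ : Formula) : K4CcCn n ((φ.box).imp ((φ.box).box))
  | Cc (φ : Formula) : K4CcCn n (((φ.box).imp φ).box)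
  | Cn (φ : Fin (n + 1) → Formula) : K4CcCn n (CnAx n φ)
  | mp {φ ψ : Formula} : K4CcCn n (φ.imp ψ) → K4CcCn n φ → K4CcCn n ψ
  | nec {φ : Formula} : K4CcCn n φ → K4CcCn n (φ.box)

open Formula

section Soundness

variable {n : ℕ} (M : Model n) (s : M.W)

lemma sat_imp (φ ψ : Formula) : Sat M s (φ.imp ψ) ↔ (Sat M s φ → Sat M s ψ) := by
  simp only [Formula.imp, Sat]; tauto

lemma sat_or (φ ψ : Formula) : Sat M s (φ.or ψ) ↔ (Sat M s φ ∨ Sat M s ψ) := by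
  simp only [Formula.or, Sat]; tauto

lemma sat_bigOr (l : List Formula) : Sat M s (bigOr l) ↔ ∃ φ ∈ l, Sat M s φ := by
  induction l with
  | nil => simp [bigOr, Formula.bot, Sat]
  | cons a l ih =>
    have h : bigOr (a :: l) = a.or (bigOr l) := rfl
    simp [h, sat_or, ih]

lemma sat_bigAnd (l : List Formula) : Sat M s (bigAnd l) ↔ ∀ φ ∈ l, Sat M s φ := by
  induction l with
  | nil => simp [bigAnd, Formula.top, Formula.bot, Sat]
  | cons a l ih =>
    have h : bigAnd (a :: l) = a.and (bigAnd l) := rfl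
    simp [h, Sat, ih]

lemma mem_pairs {m : ℕ} (p : Fin m × Fin m) : p ∈ pairs m ↔ p.1 < p.2 := by
  simp [pairs, List.product]

variable {M s}

lemma Model.star_refl_of_star (hM : K45 M) {t : M.W} (h : M.star s t) : M.star t t := by
  obtain ⟨u, _, i, hi⟩ := Relation.TransGen.tail'_iff.1 h
  exact .single ⟨i, (hM i).2 _ _ _ hi hi⟩

lemma sat_CnAx (hM : K45 M) (φ : Fin (n + 1) → Formula) : Sat M s (CnAx n φ) := by
  rw [CnAx, sat_imp, sat_bigOr]
  intro h
  by_contra! hno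
  have hstep : ∀ i : Fin (n + 1), ∃ (a : Fin n) (u t : M.W), M.R a s u ∧
      Relation.ReflTransGen (fun x y => ∃ i, M.R i x y) u t ∧ ¬ Sat M t (φ i) := by
    intro i
    have hi := hno (φ i).box (by simp)
    simp only [Sat, not_forall] at hi
    obtain ⟨t, hst, ht⟩ := hi
    obtain ⟨u, ⟨a, ha⟩, hut⟩ := Relation.TransGen.head'_iff.1 hst
    exact ⟨a, u, t, ha, hut, ht⟩
  choose a u t ha hut ht using hstep
  obtain ⟨i, j, hij, hai⟩ : ∃ i j : Fin (n + 1), i < j ∧ a i = a j := by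
    obtain ⟨i, j, hne, he⟩ := Fintype.exists_ne_map_eq_of_card_lt a (by simp)
    rcases lt_or_gt_of_ne hne with h | h
    exacts [⟨i, j, h, he⟩, ⟨j, i, h, he.symm⟩]
  have hu := h (u i) (.single ⟨a i, ha i⟩)
  rw [sat_bigAnd] at hu
  have hor := hu _ (List.mem_map_of_mem ((mem_pairs (i, j)).2 hij))
  rw [sat_or] at hor
  rcases hor with hb | hb
  · exact ht i (hb _ (.head' ⟨a i, (hM _).2 _ _ _ (ha i) (ha i)⟩ (hut i)))
  · exact ht j (hb _ (.head' ⟨a i, (hM _).2 _ _ _ (ha i) (hai ▸ ha j)⟩ (hut j)))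

lemma K4CcCn.sound {φ : Formula} (h : K4CcCn n φ) (hM : K45 M) (s : M.W) : Sat M s φ := by
  induction h generalizing s with
  | taut h => exact h (Sat M s) (fun _ => Iff.rfl) (fun _ _ => Iff.rfl)
  | K φ ψ =>
    simp only [sat_imp, Sat]
    exact fun h₁ h₂ t ht => h₁ t ht (h₂ t ht)
  | four φ =>
    simp only [sat_imp, Sat]
    exact fun h t ht u hu => h u (ht.trans hu)
  | Cc φ =>
    intro t ht
    rw [sat_imp]
    exact fun h => h t (Model.star_refl_of_star hM ht)
  | Cn φ => exact sat_CnAx hM φ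
  | mp _ _ ih₁ ih₂ => exact (sat_imp M s _ _).1 (ih₁ s) (ih₂ s)
  | nec _ ih => exact fun t _ => ih t

end Soundness

section CanonicalWorlds

/-- A theory: a set of formulas containing all theorems and closed under modus ponens. -/
structure IsTheory (n : ℕ) (T : Set Formula) : Prop where
  thm : ∀ {φ}, K4CcCn n φ → φ ∈ T
  mp : ∀ {φ ψ}, φ.imp ψ ∈ T → φ ∈ T → ψ ∈ T

variable {n : ℕ}

lemma IsTheory.cond {T : Set Formula} (hT : IsTheory n T) (φ : Formula) :
    IsTheory n {ψ | φ.imp ψ ∈ T} where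
  thm {ψ} h := hT.mp (hT.thm (.taut (φ := ψ.imp (φ.imp ψ)) fun v hn ha => by
    simp only [Formula.imp, hn, ha]; tauto)) (hT.thm h)
  mp {ψ χ} h₁ h₂ := hT.mp (hT.mp (hT.thm (.taut
    (φ := (φ.imp (ψ.imp χ)).imp ((φ.imp ψ).imp (φ.imp χ))) fun v hn ha => by
      simp only [Formula.imp, hn, ha]; tauto)) h₁) h₂

lemma IsTheory.unbox {T : Set Formula} (hT : IsTheory n T) :
    IsTheory n {ψ | ψ.box ∈ T} where
  thm h := hT.thm h.nec
  mp h₁ h₂ := hT.mp (hT.mp (hT.thm (.K _ _)) h₁) h₂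

lemma isTheory_theorems : IsTheory n {φ | K4CcCn n φ} := ⟨id, .mp⟩

/-- A world of the canonical model: a complete consistent theory. -/
structure World (n : ℕ) where
  carrier : Set Formula
  isTheory : IsTheory n carrier
  neg_mem : ∀ φ, φ.neg ∈ carrier ↔ φ ∉ carrier

instance : Membership Formula (World n) := ⟨fun x φ => φ ∈ x.carrier⟩

lemma IsTheory.exists_world {T : Set Formula} (hT : IsTheory n T) {φ : Formula} (hφ : φ ∉ T) :
    ∃ x : World n, T ⊆ x.carrier ∧ φ ∉ x := by
  obtain ⟨S, hTS, hS⟩ := zorn_subset_nonempty {S | IsTheory n S ∧ φ ∉ S} (by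
    intro c hc hch hne
    refine ⟨⋃₀ c, ⟨⟨fun {ψ} h => ?_, fun {ψ χ} h₁ h₂ => ?_⟩, ?_⟩, fun s hs =>
      Set.subset_sUnion_of_mem hs⟩
    · obtain ⟨s, hs⟩ := hne
      exact ⟨s, hs, (hc hs).1.thm h⟩
    · obtain ⟨s, hs, hs₁⟩ := h₁
      obtain ⟨t, ht, ht₂⟩ := h₂
      rcases hch.total hs ht with h | h
      · exact ⟨t, ht, (hc ht).1.mp (h hs₁) ht₂⟩
      · exact ⟨s, hs, (hc hs).1.mp hs₁ (h ht₂)⟩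
    · rintro ⟨s, hs, h⟩
      exact (hc hs).2 h) T ⟨hT, hφ⟩
  have hthy := hS.prop.1
  have hcond : ∀ ψ, ψ ∉ S → ψ.imp φ ∈ S := by
    intro ψ hψ
    by_contra hno
    refine hψ (hS.le_of_ge (y := {χ | ψ.imp χ ∈ S}) ⟨hthy.cond ψ, hno⟩ (fun χ hχ => ?_) ?_)
    · exact hthy.mp (hthy.thm (.taut (φ := χ.imp (ψ.imp χ)) fun v hn ha => by
        simp only [Formula.imp, hn, ha]; tauto)) hχ
    · exact hthy.thm (.taut fun v hn ha => by simp only [Formula.imp, hn, ha]; tauto)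
  refine ⟨⟨S, hthy, fun ψ => ⟨fun h₁ h₂ => hS.prop.2 ?_, fun h => ?_⟩⟩, hTS, hS.prop.2⟩
  · exact hthy.mp (hthy.mp (hthy.thm (.taut (φ := ψ.neg.imp (ψ.imp φ)) fun v hn ha => by
      simp only [Formula.imp, hn, ha]; tauto)) h₁) h₂
  · by_contra h'
    exact hS.prop.2 (hthy.mp (hthy.mp (hthy.thm (.taut
      (φ := (ψ.imp φ).imp ((ψ.neg.imp φ).imp φ)) fun v hn ha => by
        simp only [Formula.imp, hn, ha]; tauto)) (hcond _ h)) (hcond _ h'))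

namespace World

variable (x : World n)

lemma mem_of_thm {φ : Formula} (h : K4CcCn n φ) : φ ∈ x := x.isTheory.thm h

lemma mem_neg (φ : Formula) : φ.neg ∈ x ↔ φ ∉ x := x.neg_mem φ

variable {x} in
lemma mem_mp {φ ψ : Formula} (h : φ.imp ψ ∈ x) (hφ : φ ∈ x) : ψ ∈ x := x.isTheory.mp h hφ

lemma mem_and (φ ψ : Formula) : φ.and ψ ∈ x ↔ φ ∈ x ∧ ψ ∈ x := by
  refine ⟨fun h => ⟨mem_mp (x.mem_of_thm (.taut fun v hn ha => ?_)) h,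
    mem_mp (x.mem_of_thm (.taut fun v hn ha => ?_)) h⟩, fun h =>
    mem_mp (mem_mp (x.mem_of_thm (.taut (φ := φ.imp (ψ.imp (φ.and ψ))) fun v hn ha => ?_)) h.1) h.2⟩
  all_goals simp only [Formula.imp, hn, ha]; tauto

lemma mem_imp (φ ψ : Formula) : φ.imp ψ ∈ x ↔ (φ ∈ x → ψ ∈ x) := by
  simp only [Formula.imp, mem_neg, mem_and]; tauto

lemma mem_or (φ ψ : Formula) : φ.or ψ ∈ x ↔ (φ ∈ x ∨ ψ ∈ x) := by
  simp only [Formula.or, mem_neg, mem_and]; tauto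

lemma mem_bigOr (l : List Formula) : bigOr l ∈ x ↔ ∃ φ ∈ l, φ ∈ x := by
  induction l with
  | nil => simp [bigOr, Formula.bot, mem_and, mem_neg]
  | cons a l ih =>
    have h : bigOr (a :: l) = a.or (bigOr l) := rfl
    simp [h, mem_or, ih]

lemma mem_bigAnd (l : List Formula) : bigAnd l ∈ x ↔ ∀ φ ∈ l, φ ∈ x := by
  induction l with
  | nil => simp [bigAnd, Formula.top, Formula.bot, mem_and, mem_neg]
  | cons a l ih =>
    have h : bigAnd (a :: l) = a.and (bigAnd l) := rfl
    simp [h, mem_and, ih]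

/-- The canonical accessibility relation. -/
def Acc (x y : World n) : Prop := ∀ φ : Formula, φ.box ∈ x → φ ∈ y

variable {x} {y z : World n}

lemma box_box_mem {φ : Formula} (h : φ.box ∈ x) : φ.box.box ∈ x :=
  mem_mp (x.mem_of_thm (.four φ)) h

lemma Acc.box_mem (h : Acc x y) {φ : Formula} (hφ : φ.box ∈ x) : φ.box ∈ y :=
  h _ (box_box_mem hφ)

lemma Acc.trans (h₁ : Acc x y) (h₂ : Acc y z) : Acc x z := fun φ hφ => h₂ φ (h₁.box_mem hφ)

lemma Acc.refl_right (h : Acc x y) : Acc y y := fun φ =>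
  (mem_imp y _ _).1 (h _ (x.mem_of_thm (.Cc φ)))

lemma exists_acc {φ : Formula} (h : φ.box ∉ x) : ∃ y, Acc x y ∧ φ ∉ y :=
  x.isTheory.unbox.exists_world h

lemma box_mono {φ ψ : Formula} (h : K4CcCn n (φ.imp ψ)) (hφ : φ.box ∈ x) : ψ.box ∈ x :=
  mem_mp (mem_mp (x.mem_of_thm (.K _ _)) (x.mem_of_thm h.nec)) hφ

/-- Among `n + 1` successors, some two can be replaced by a single successor refuting all
the boxed formulas from a given list that are refuted by either of them. -/
lemma exists_merge (m : Fin (n + 1) → World n) (hm : ∀ i, Acc x (m i)) (L : List Formula) :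
    ∃ i j, i < j ∧ ∃ y, Acc x y ∧
      ∀ χ ∈ L, χ.box ∉ m i ∨ χ.box ∉ m j → χ.box ∉ y := by
  classical
  let φ : Fin (n + 1) → Formula := fun i => bigOr ((L.map box).filter (· ∉ m i))
  have hφ : ∀ i, φ i ∉ m i := by
    intro i
    simp only [φ, mem_bigOr, List.mem_filter, decide_eq_true_eq]
    tauto
  have hpre : (bigAnd ((pairs (n + 1)).map
      (fun p => Formula.or ((φ p.1).box) ((φ p.2).box)))).box ∉ x := by
    intro h
    obtain ⟨ψ, hψ, hx⟩ := (mem_bigOr _ _).1 (mem_mp (x.mem_of_thm (.Cn φ)) h)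
    obtain ⟨i, -, rfl⟩ := List.mem_map.1 hψ
    exact hφ i (hm i _ hx)
  obtain ⟨y, hxy, hy⟩ := exists_acc hpre
  simp only [mem_bigAnd, List.mem_map, not_forall] at hy
  obtain ⟨_, ⟨⟨i, j⟩, hij, rfl⟩, hor⟩ := hy
  rw [mem_or, not_or] at hor
  have key : ∀ k, (φ k).box ∉ y → ∀ χ ∈ L, χ.box ∉ m k → χ.box ∉ y := by
    intro k hk χ hχ hmk hy
    refine hk (box_mono ?_ (box_box_mem hy))
    by_contra hno
    obtain ⟨z, -, hz⟩ := isTheory_theorems.exists_world hno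
    rw [mem_imp] at hz
    exact hz fun h => (mem_bigOr _ _).2 ⟨_, by simpa using ⟨hχ, hmk⟩, h⟩
  refine ⟨i, j, (mem_pairs _).1 hij, y, hxy, fun χ hχ h => ?_⟩
  exact h.elim (key i hor.1 χ hχ) (key j hor.2 χ hχ)

/-- At most `n` successors suffice to refute all boxed formulas from a finite list that
fail at a world. -/
lemma exists_cover (x : World n) (L : List Formula) :
    ∃ T : Finset (World n), T.card ≤ n ∧ (∀ y ∈ T, Acc x y) ∧
      ∀ χ ∈ L, χ.box ∉ x → ∃ y ∈ T, χ.box ∉ y := by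
  classical
  induction L with
  | nil => exact ⟨∅, by simp⟩
  | cons ψ L ih =>
    obtain ⟨T, hcard, hacc, hcov⟩ := ih
    by_cases hψ : ψ.box ∈ x
    · refine ⟨T, hcard, hacc, fun χ hχ hx => ?_⟩
      rcases List.mem_cons.1 hχ with rfl | h
      exacts [absurd hψ hx, hcov χ h hx]
    obtain ⟨z, hxz, hz⟩ := exists_acc hψ
    have hacc' : ∀ y ∈ insert z T, Acc x y := by simpa using ⟨hxz, hacc⟩
    have hcov' : ∀ χ ∈ ψ :: L, χ.box ∉ x → ∃ y ∈ insert z T, χ.box ∉ y := by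
      intro χ hχ hx
      rcases List.mem_cons.1 hχ with rfl | h
      · exact ⟨z, by simp, fun h => hz (hxz.refl_right _ h)⟩
      · obtain ⟨y, hy, hy'⟩ := hcov χ h hx
        exact ⟨y, by simp [hy], hy'⟩
    by_cases hle : (insert z T).card ≤ n
    · exact ⟨_, hle, hacc', hcov'⟩
    have hins : (insert z T).card = n + 1 := by
      have := Finset.card_insert_le z T
      omega
    let e := (Finset.equivFinOfCardEq hins).symm
    obtain ⟨i, j, hij, y, hxy, hy⟩ := exists_merge (fun i => (e i : World n))
      (fun i => hacc' _ (e i).2) (ψ :: L)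
    have hne : (e j : World n) ≠ e i := fun h => hij.ne' (e.injective (Subtype.ext h))
    refine ⟨insert y (((insert z T).erase (e i)).erase (e j)), ?_, ?_, ?_⟩
    · refine (Finset.card_insert_le _ _).trans ?_
      rw [Finset.card_erase_of_mem (Finset.mem_erase.2 ⟨hne, (e j).2⟩),
        Finset.card_erase_of_mem (e i).2, hins]
      have := i.2
      have := j.2
      omega
    · intro w hw
      rcases Finset.mem_insert.1 hw with rfl | h
      exacts [hxy, hacc' _ (Finset.mem_of_mem_erase (Finset.mem_of_mem_erase h))]
    · intro χ hχ hx
      obtain ⟨w, hw, hw'⟩ := hcov' χ hχ hx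
      by_cases hi : w = e i
      · exact ⟨y, by simp, hy χ hχ (.inl (hi ▸ hw'))⟩
      by_cases hj : w = e j
      · exact ⟨y, by simp, hy χ hχ (.inr (hj ▸ hw'))⟩
      · exact ⟨w, Finset.mem_insert_of_mem
          (Finset.mem_erase.2 ⟨hj, Finset.mem_erase.2 ⟨hi, hw⟩⟩), hw'⟩

end World

end CanonicalWorlds

section Gateway

open World

variable {n : ℕ}

/-- A non-root state of the gateway model: it carries the truth values of `pt` and belongs to a
cluster of `agent`, and every other agent considers the cluster of `gate` possible. -/
structure Node (n : ℕ) where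
  pt : World n
  gate : World n
  agent : Fin n
  pt_refl : Acc pt pt
  acc : Acc pt gate

/-- The world whose cluster is seen by agent `c`; `f` gives the clusters seen from the root
`none`. -/
def target (f : Fin n → Option (World n)) (c : Fin n) : Option (Node n) → Option (World n)
  | none => f c
  | some v => if v.agent = c then some v.pt else some v.gate

/-- The gateway model with root world `x`. -/
def gatewayModel (x : World n) (f : Fin n → Option (World n)) : Model n where
  W := Option (Node n)
  nonempty := ⟨none⟩
  R c w w' := ∃ v u, w' = some v ∧ v.agent = c ∧ target f c w = some u ∧
    Acc u v.pt ∧ Acc v.pt u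
  V p w := (atom p) ∈ w.elim x Node.pt

variable {x : World n} {f : Fin n → Option (World n)}

lemma gatewayModel_K45 : K45 (gatewayModel x f) := by
  intro c
  constructor
  · rintro w _ _ ⟨v, u, rfl, rfl, hu, huv, hvu⟩ ⟨v', u', rfl, hc', hu', huv', hvu'⟩
    obtain rfl : v.pt = u' := by simpa [target] using hu'
    exact ⟨v', u, rfl, hc', hu, huv.trans huv', hvu'.trans hvu⟩
  · rintro w _ _ ⟨v, u, rfl, rfl, hu, huv, hvu⟩ ⟨v', u', rfl, hc', hu', huv', hvu'⟩
    obtain rfl : u = u' := Option.some.inj (hu.symm.trans hu')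
    exact ⟨v', v.pt, rfl, hc', by simp [target], hvu.trans huv', hvu'.trans huv⟩

lemma gatewayModel_acc_of_R {v : Node n} {c : Fin n} {w : Option (Node n)}
    (h : (gatewayModel x f).R c (some v) w) : ∃ v', w = some v' ∧ Acc v.pt v'.pt := by
  obtain ⟨v', u, rfl, -, hu, huv, -⟩ := h
  refine ⟨v', rfl, Acc.trans ?_ huv⟩
  simp only [target] at hu
  split_ifs at hu <;> cases hu
  exacts [v.pt_refl, v.acc]

lemma gatewayModel_acc_of_star {v : Node n} {w : Option (Node n)}
    (h : (gatewayModel x f).star (some v) w) : ∃ v', w = some v' ∧ Acc v.pt v'.pt := by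
  induction h with
  | single h => exact gatewayModel_acc_of_R h.choose_spec
  | tail _ h ih =>
    obtain ⟨v', rfl, h'⟩ := ih
    obtain ⟨v'', rfl, h''⟩ := gatewayModel_acc_of_R h.choose_spec
    exact ⟨v'', rfl, h'.trans h''⟩

lemma gatewayModel_star_of_target (hn : 2 ≤ n) {w : Option (Node n)} {c : Fin n} {u y : World n}
    (hu : target f c w = some u) (huu : Acc u u) (huy : Acc u y) :
    ∃ v : Node n, (gatewayModel x f).star w (some v) ∧ v.pt = y := by
  have : Nontrivial (Fin n) := Fin.nontrivial_iff_two_le.2 hn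
  obtain ⟨d, hd⟩ := exists_ne c
  have hyy := huy.refl_right
  refine ⟨⟨y, y, d, hyy, hyy⟩, .tail (.single (b := some ⟨u, y, c, huu, huy⟩) ⟨c, ?_⟩) ⟨d, ?_⟩, rfl⟩
  · exact ⟨_, u, rfl, rfl, hu, huu, huu⟩
  · exact ⟨_, y, rfl, rfl, by simp [target, hd.symm], hyy, hyy⟩

lemma gatewayModel_sat_some (hn : 2 ≤ n) (ψ : Formula) (v : Node n) :
    Sat (gatewayModel x f) (some v) ψ ↔ ψ ∈ v.pt := by
  induction ψ generalizing v with
  | atom p => exact Iff.rfl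
  | neg φ ih => simp only [Sat, mem_neg, ih]
  | and φ ψ ih₁ ih₂ => simp only [Sat, mem_and, ih₁, ih₂]
  | box φ ih =>
    constructor
    · intro h
      by_contra hno
      obtain ⟨y, hvy, hy⟩ := exists_acc hno
      obtain ⟨v', hv', rfl⟩ := gatewayModel_star_of_target (x := x) (f := f) hn (w := some v)
        (c := v.agent) (by simp [target]) v.pt_refl hvy
      exact hy ((ih v').1 (h _ hv'))
    · intro h w hw
      obtain ⟨v', rfl, hv⟩ := gatewayModel_acc_of_star hw
      exact (ih v').2 (hv _ h)

/-- The formulas `χ` such that `Cχ` is a subformula outside the scope of every `C`. -/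
def outerBoxes : Formula → List Formula
  | .atom _ => []
  | .neg φ => outerBoxes φ
  | .and φ ψ => outerBoxes φ ++ outerBoxes ψ
  | .box φ => [φ]

lemma gatewayModel_sat_none (hn : 2 ≤ n) (hf : ∀ c y, f c = some y → Acc x y) (ψ : Formula)
    (hcov : ∀ χ ∈ outerBoxes ψ, χ.box ∉ x → ∃ c y, f c = some y ∧ χ.box ∉ y) :
    Sat (gatewayModel x f) none ψ ↔ ψ ∈ x := by
  induction ψ with
  | atom p => exact Iff.rfl
  | neg φ ih => simp only [Sat, mem_neg, ih hcov]
  | and φ ψ ih₁ ih₂ =>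
    simp only [Sat, mem_and, ih₁ fun χ h => hcov χ (List.mem_append_left _ h),
      ih₂ fun χ h => hcov χ (List.mem_append_right _ h)]
  | box φ _ =>
    constructor
    · intro h
      by_contra hno
      obtain ⟨c, u, hu, hφ⟩ := hcov φ (by simp [outerBoxes]) hno
      obtain ⟨y, huy, hy⟩ := exists_acc hφ
      obtain ⟨v, hv, rfl⟩ := gatewayModel_star_of_target (x := x) (w := none) hn hu
        (hf c u hu).refl_right huy
      exact hy ((gatewayModel_sat_some hn φ v).1 (h _ hv))
    · intro h w hw
      obtain ⟨_, ⟨c, v, u, rfl, -, hu, huv, -⟩, hvw⟩ := Relation.TransGen.head'_iff.1 hw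
      have hxv := (hf c u hu).trans huv
      have : ∃ v', w = some v' ∧ Acc x v'.pt := by
        rcases Relation.reflTransGen_iff_eq_or_transGen.1 hvw with rfl | hs
        · exact ⟨v, rfl, hxv⟩
        · obtain ⟨v', rfl, hv'⟩ := gatewayModel_acc_of_star hs
          exact ⟨v', rfl, hxv.trans hv'⟩
      obtain ⟨v', rfl, hv'⟩ := this
      exact (gatewayModel_sat_some hn φ v').2 (hv' _ h)

lemma K4CcCn.complete (hn : 2 ≤ n) {φ : Formula}
    (h : ∀ M : Model n, K45 M → ∀ s : M.W, Sat M s φ) : K4CcCn n φ := by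
  by_contra hno
  obtain ⟨x, -, hx⟩ := isTheory_theorems.exists_world hno
  obtain ⟨T, hcard, hacc, hcov⟩ := exists_cover x (outerBoxes φ)
  obtain ⟨e⟩ : Nonempty (T ↪ Fin n) := Function.Embedding.nonempty_of_card_le (by simpa)
  let f : Fin n → Option (World n) := fun c => (Function.partialInv e c).map Subtype.val
  refine hx ((gatewayModel_sat_none (f := f) hn ?_ φ ?_).1 (h _ gatewayModel_K45 none))
  · intro c y hy
    obtain ⟨t, -, rfl⟩ := Option.map_eq_some_iff.1 hy
    exact hacc _ t.2
  · intro χ hχ hxχ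
    obtain ⟨y, hy, hyχ⟩ := hcov χ hχ hxχ
    exact ⟨e ⟨y, hy⟩, y, by simp [f, Function.partialInv_left e.injective], hyχ⟩

end Gateway

/-- `K4CcCn` (`n ≥ 2`) is sound and complete with respect to the class of all K45
models for `n` agents. -/
theorem K4CcCn_sound_complete :
    ∀ n : ℕ, 2 ≤ n → ∀ φ : Formula,
      K4CcCn n φ ↔ (∀ M : Model n, K45 M → ∀ s : M.W, Sat M s φ) :=
  fun _ hn _ => ⟨fun h _ hM s => h.sound hM s, K4CcCn.complete hn⟩
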